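/- arXiv:math/0212097 — 3 statements merged into one kernel-verified Lean document; each statement's English description precedes it below -/
import Mathlib

section
/- Let 1 ≤ d < n and let I be a superconsistent set of (d+1)-element subsets of [n−1], i.e., for every (d+2)-element subset J of [n−1], the intersection of I with the (d+1)-packet of J, ordered lexicographically, is either empty, the whole packet, an initial segment of odd length, or a final segment whose length is congruent to d modulo 2. Then there exists a snug partition W of the d-element subsets of [n−1] whose inversion set equals I, i.e., such that for every (d+1)-element subset X = {x_1 < … < x_{d+1}} of [n−1], X ∈ I if and only if X∖{x_{d+1}} and X∖{x_d} lie in the same block of W. -/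
/-- The snug rectangle `r(a₁,…,a_{k+1})`: all `k`-element subsets `{y₁<…<y_k}`
with `aᵢ ≤ yᵢ ≤ a_{i+1} - 1`. -/
def snugRect {k : ℕ} (a : Fin (k + 1) → ℕ) : Set (Finset ℕ) :=
  {Y | ∃ y : Fin k → ℕ,
    (∀ i : Fin k, a i.castSucc ≤ y i ∧ y i + 1 ≤ a i.succ) ∧
    Y = Finset.image y Finset.univ}

/-- `B` is a snug rectangle of `k`-subsets of `[n-1]`, with parameters in `[n]`. -/
def IsSnugRect (n k : ℕ) (B : Set (Finset ℕ)) : Prop :=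
  ∃ a : Fin (k + 1) → ℕ, StrictMono a ∧ (∀ i, 1 ≤ a i ∧ a i ≤ n) ∧ B = snugRect a

/-- A snug partition of the `k`-element subsets of `[n-1] = {1,…,n-1}`. -/
def SnugPartition (n k : ℕ) (W : Set (Set (Finset ℕ))) : Prop :=
  (∀ B ∈ W, IsSnugRect n k B) ∧
  ∀ Y : Finset ℕ, Y ⊆ Finset.Icc 1 (n - 1) → Y.card = k →
    ∃! B, B ∈ W ∧ Y ∈ B

/-- `Y` and `Z` lie in a common block of `W`. -/
def SameBlock (W : Set (Set (Finset ℕ))) (Y Z : Finset ℕ) : Prop :=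
  ∃ B ∈ W, Y ∈ B ∧ Z ∈ B

/-- Lexicographic comparison of finite sets via their increasingly sorted lists. -/
def lexLtN (A B : Finset ℕ) : Prop :=
  List.Lex (· < ·) (A.sort (· ≤ ·)) (B.sort (· ≤ ·))


def SupCons (d n : ℕ) (I : Set (Finset ℕ)) : Prop :=
    ∀ J : Finset ℕ, J ⊆ Finset.Icc 1 (n - 1) → J.card = d + 2 →
      I ∩ {Y : Finset ℕ | Y ⊆ J ∧ Y.card = d + 1} = ∅ ∨
      {Y : Finset ℕ | Y ⊆ J ∧ Y.card = d + 1} ⊆ I ∨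
      ((∀ Y, Y ⊆ J → Y.card = d + 1 → ∀ Z, Z ⊆ J → Z.card = d + 1 →
          Z ∈ I → lexLtN Y Z → Y ∈ I) ∧
        Odd (I ∩ {Y : Finset ℕ | Y ⊆ J ∧ Y.card = d + 1}).ncard) ∨
      ((∀ Y, Y ⊆ J → Y.card = d + 1 → ∀ Z, Z ⊆ J → Z.card = d + 1 →
          Z ∈ I → lexLtN Z Y → Y ∈ I) ∧
        (I ∩ {Y : Finset ℕ | Y ⊆ J ∧ Y.card = d + 1}).ncard % 2 = d % 2)

lemma sort_insert_min (s : Finset ℕ) (m : ℕ) (h : ∀ x ∈ s, m < x) :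
    (insert m s).sort (· ≤ ·) = m :: s.sort (· ≤ ·) := by
  apply Finset.sort_insert
  · intro b hb; exact (h b hb).le
  · intro hm; exact lt_irrefl _ (h m hm)

lemma lex_erase (J : Finset ℕ) : ∀ a b, a ∈ J → b ∈ J → b < a →
    lexLtN (J.erase a) (J.erase b) := by
  induction J using Finset.induction_on_min with
  | empty => simp
  | insert m s hm ih =>
    intro a b ha hb hab
    have hms : m ∉ s := fun h => lt_irrefl _ (hm m h)
    have has : a ∈ s := by
      rcases Finset.mem_insert.1 ha with rfl | h
      · rcases Finset.mem_insert.1 hb with rfl | h'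
        · omega
        · have := hm b h'; omega
      · exact h
    have ham : m ≠ a := by rintro rfl; exact hms has
    have e1 : (insert m s).erase a = insert m (s.erase a) :=
      Finset.erase_insert_of_ne ham
    rcases eq_or_ne b m with rfl | hbm
    · unfold lexLtN
      rw [e1, Finset.erase_insert hms, sort_insert_min _ _ (fun x hx => hm x (Finset.mem_of_mem_erase hx))]
      have : a ∈ s.sort (· ≤ ·) := by simpa using has
      cases hL : s.sort (· ≤ ·) with
      | nil => rw [hL] at this; simp at this
      | cons c L =>
        apply List.Lex.rel
        apply hm
        have : c ∈ s.sort (· ≤ ·) := by rw [hL]; simp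
        simpa using this
    · have hbs : b ∈ s := by
        rcases Finset.mem_insert.1 hb with rfl | h
        · exact absurd rfl hbm
        · exact h
      have e2 : (insert m s).erase b = insert m (s.erase b) :=
        Finset.erase_insert_of_ne hbm.symm
      have := ih a b has hbs hab
      unfold lexLtN at this ⊢
      rw [e1, e2, sort_insert_min _ _ (fun x hx => hm x (Finset.mem_of_mem_erase hx)),
        sort_insert_min _ _ (fun x hx => hm x (Finset.mem_of_mem_erase hx))]
      exact List.Lex.cons this

lemma packet_count (d : ℕ) (I : Set (Finset ℕ)) (J : Finset ℕ) (hc : J.card = d + 2)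
    (K : Finset ℕ) (hKJ : K ⊆ J) (hK : ∀ z ∈ J, (J.erase z ∈ I ↔ z ∈ K)) :
    (I ∩ {Y : Finset ℕ | Y ⊆ J ∧ Y.card = d + 1}).ncard = K.card := by
  have : I ∩ {Y : Finset ℕ | Y ⊆ J ∧ Y.card = d + 1} = ((K.image J.erase : Finset (Finset ℕ)) : Set (Finset ℕ)) := by
    ext Y
    simp only [Set.mem_inter_iff, Set.mem_ofPred_eq, Finset.coe_image, Set.mem_image, Finset.mem_coe]
    constructor
    · rintro ⟨hI, hY, hYc⟩
      have h1 : (J \ Y).card = 1 := by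
        rw [Finset.card_sdiff_of_subset hY]; omega
      obtain ⟨x, hx⟩ := Finset.card_eq_one.1 h1
      have hxJ : x ∈ J \ Y := by rw [hx]; simp
      have hYe : J.erase x = Y := by
        rw [Finset.erase_eq, ← hx, Finset.sdiff_sdiff_eq_self hY]
      refine ⟨x, ?_, hYe⟩
      rw [← hK x (Finset.mem_sdiff.1 hxJ).1, hYe]; exact hI
    · rintro ⟨x, hx, rfl⟩
      refine ⟨(hK x (hKJ hx)).2 hx, Finset.erase_subset _ _, ?_⟩
      rw [Finset.card_erase_of_mem (hKJ hx)]; omega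
  rw [this, Set.ncard_coe_finset, Finset.card_image_of_injOn]
  intro a ha b hb hab
  exact (Finset.erase_inj J (hKJ ha)).1 hab

lemma core {d n : ℕ} {I : Set (Finset ℕ)} (hS : SupCons d n I) (J : Finset ℕ)
    (hJ : J ⊆ Finset.Icc 1 (n - 1)) (hc : J.card = d + 2) (x x' : ℕ) (hx : x ∈ J) (hx' : x' ∈ J)
    (hlt : x < x') (hcons : ∀ z ∈ J, z ≤ x ∨ x' ≤ z)
    (hne : ¬ (J.erase x ∈ I ↔ J.erase x' ∈ I)) :
    ∀ z ∈ J, (J.erase z ∈ I ↔ (x < z ↔ Even (J.filter (x' < ·)).card)) := by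
  have hcard : ∀ z ∈ J, (J.erase z).card = d + 1 := fun z hz => by
    rw [Finset.card_erase_of_mem hz]; omega
  have hsub : ∀ z, J.erase z ⊆ J := fun z => Finset.erase_subset _ _
  have hfil : J.filter (x < ·) = insert x' (J.filter (x' < ·)) := by
    ext z; simp only [Finset.mem_filter, Finset.mem_insert]
    constructor
    · rintro ⟨h1, h2⟩
      rcases hcons z h1 with h | h
      · omega
      · rcases h.eq_or_lt with h | h
        · exact Or.inl h.symm
        · exact Or.inr ⟨h1, h⟩
    · rintro (rfl | ⟨h1, h2⟩)
      · exact ⟨hx', hlt⟩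
      · exact ⟨h1, by omega⟩
  have hfc : (J.filter (x < ·)).card = (J.filter (x' < ·)).card + 1 := by
    rw [hfil, Finset.card_insert_of_notMem (by simp)]
  rcases hS J hJ hc with h | h | ⟨h, hodd⟩ | ⟨h, hodd⟩
  · exfalso
    have : ∀ z ∈ J, J.erase z ∉ I := fun z hz hI => by
      have : J.erase z ∈ I ∩ {Y : Finset ℕ | Y ⊆ J ∧ Y.card = d + 1} := ⟨hI, hsub z, hcard z hz⟩
      rw [h] at this; exact this
    exact hne (iff_of_false (this x hx) (this x' hx'))
  · exfalso
    exact hne (iff_of_true (h ⟨hsub x, hcard x hx⟩) (h ⟨hsub x', hcard x' hx'⟩))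
  · have hup : ∀ a ∈ J, ∀ b ∈ J, b < a → J.erase b ∈ I → J.erase a ∈ I := fun a ha b hb hab hI =>
      h _ (hsub a) (hcard a ha) _ (hsub b) (hcard b hb) hI (lex_erase J a b ha hb hab)
    have h1 : J.erase x ∉ I := fun h1 => hne (iff_of_true h1 (hup x' hx' x hx hlt h1))
    have h2 : J.erase x' ∈ I := by by_contra h2; exact hne (iff_of_false h1 h2)
    have hK : ∀ z ∈ J, (J.erase z ∈ I ↔ z ∈ J.filter (x < ·)) := by
      intro z hz
      simp only [Finset.mem_filter, hz, true_and]
      constructor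
      · intro hI
        by_contra hzx
        rcases (not_lt.1 hzx).eq_or_lt with rfl | h3
        · exact h1 hI
        · exact h1 (hup x hx z hz h3 hI)
      · intro hxz
        rcases (show x' ≤ z by have := hcons z hz; omega).eq_or_lt with rfl | h3
        · exact h2
        · exact hup z hz x' hx' h3 h2
    rw [packet_count d I J hc _ (Finset.filter_subset _ _) hK, hfc] at hodd
    have hev : Even (J.filter (x' < ·)).card := by
      rw [Nat.odd_add_one, Nat.not_odd_iff_even] at hodd; exact hodd
    intro z hz
    rw [hK z hz]; simp [hz, hev]
  · have hup : ∀ a ∈ J, ∀ b ∈ J, b < a → J.erase a ∈ I → J.erase b ∈ I := fun a ha b hb hab hI =>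
      h _ (hsub b) (hcard b hb) _ (hsub a) (hcard a ha) hI (lex_erase J a b ha hb hab)
    have h1 : J.erase x' ∉ I := fun h1 => hne (iff_of_true (hup x' hx' x hx hlt h1) h1)
    have h2 : J.erase x ∈ I := by by_contra h2; exact hne (iff_of_false h2 h1)
    have hK : ∀ z ∈ J, (J.erase z ∈ I ↔ z ∈ J.filter (fun t => ¬ x < t)) := by
      intro z hz
      simp only [Finset.mem_filter, hz, true_and]
      constructor
      · intro hI hzx
        rcases (show x' ≤ z by have := hcons z hz; omega).eq_or_lt with rfl | h3
        · exact h1 hI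
        · exact h1 (hup z hz x' hx' h3 hI)
      · intro hxz
        rcases (not_lt.1 hxz).eq_or_lt with rfl | h3
        · exact h2
        · exact hup x hx z hz h3 h2
    rw [packet_count d I J hc _ (Finset.filter_subset _ _) hK] at hodd
    have hsum := Finset.card_filter_add_card_filter_not (s := J) (x < ·)
    have hev : ¬ Even (J.filter (x' < ·)).card := by
      rw [Nat.even_iff]; omega
    intro z hz
    rw [hK z hz]; simp [hz, hev]

/-- Three values in the same gap of `T`. -/
lemma three {d n : ℕ} {I : Set (Finset ℕ)} (hS : SupCons d n I) (T : Finset ℕ)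
    (hT : T ⊆ Finset.Icc 1 (n - 1)) (hc : T.card + 1 = d) (x y z : ℕ)
    (hxy : x < y) (hyz : y < z) (hx1 : 1 ≤ x) (hzn : z ≤ n - 1)
    (hgap : ∀ t ∈ T, t < x ∨ z < t) (E : Prop) (hE : E ↔ Even (T.filter (z < ·)).card) :
    (insert x (insert z T) ∈ I ↔ E) ↔
      ((insert x (insert y T) ∈ I ↔ E) ∧ (insert y (insert z T) ∈ I ↔ E)) := by
  have hxT : x ∉ T := fun h => by have := hgap x h; omega
  have hyT : y ∉ T := fun h => by have := hgap y h; omega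
  have hzT : z ∉ T := fun h => by have := hgap z h; omega
  set J := insert x (insert y (insert z T)) with hJdef
  have hJ : J ⊆ Finset.Icc 1 (n - 1) := by
    intro t ht
    simp only [hJdef, Finset.mem_insert] at ht
    rcases ht with rfl | rfl | rfl | ht
    · simp; omega
    · simp; omega
    · simp; omega
    · exact hT ht
  have hJc : J.card = d + 2 := by
    rw [hJdef, Finset.card_insert_of_notMem, Finset.card_insert_of_notMem,
      Finset.card_insert_of_notMem hzT]
    · omega
    · simp [hyT]; omega
    · simp [hxT]; omega
  have ex : J.erase x = insert y (insert z T) := by grind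
  have ey : J.erase y = insert x (insert z T) := by grind
  have ez : J.erase z = insert x (insert y T) := by grind
  have c1 : (J.filter (z < ·)).card = (T.filter (z < ·)).card := by
    congr 1; grind
  have c2 : (J.filter (y < ·)).card = (T.filter (z < ·)).card + 1 := by
    rw [← Finset.card_insert_of_notMem (s := T.filter (z < ·)) (a := z) (by simp)]
    congr 1; grind
  have k1 := core hS J hJ hJc x y (by grind) (by grind) hxy (by grind)
  have k2 := core hS J hJ hJc y z (by grind) (by grind) hyz (by grind)
  rw [c2, Nat.even_add_one, ← hE] at k1
  rw [c1, ← hE] at k2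
  have k1z := fun h => k1 h z (by grind)
  have k2x := fun h => k2 h x (by grind)
  have k1x := fun h => k1 h x (by grind)
  have k2y := fun h => k2 h y (by grind)
  have k1y := fun h => k1 h y (by grind)
  have k2z := fun h => k2 h z (by grind)
  rw [ex, ey] at k1x k1y k1z
  rw [ez] at k1z
  rw [ez, ey] at k2x k2y k2z
  rw [ex] at k2x
  have o1 : ¬ y < x := by omega
  have o2 : x < z := by omega
  simp only [hxy, hyz, o1, o2, lt_irrefl, true_iff, false_iff] at k1x k1y k1z k2x k2y k2z
  clear k1 k2 c1 c2 hE hJc hJ ex ey ez hJdef hT hgap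
  generalize (insert y (insert z T) ∈ I) = p at *
  generalize (insert x (insert z T) ∈ I) = q at *
  generalize (insert x (insert y T) ∈ I) = r at *
  clear hS
  by_cases E <;> by_cases p <;> by_cases q <;> by_cases r <;> simp_all

lemma four {d n : ℕ} {I : Set (Finset ℕ)} (hS : SupCons d n I) (T : Finset ℕ)
    (hT : T ⊆ Finset.Icc 1 (n - 1)) (hc : T.card + 1 = d) (x y w : ℕ)
    (hxy : x < y) (hx1 : 1 ≤ x) (hyn : y ≤ n - 1) (hw : w ∈ Finset.Icc 1 (n - 1))
    (hwT : w ∉ T) (hwg : w < x ∨ y < w)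
    (hgap : ∀ t ∈ T, t < x ∨ y < t)
    (h : insert x (insert y T) ∈ I ↔ Even (T.filter (y < ·)).card) :
    (insert w (insert x T) ∈ I ↔ insert w (insert y T) ∈ I) := by
  have hxT : x ∉ T := fun h => by have := hgap x h; omega
  have hyT : y ∉ T := fun h => by have := hgap y h; omega
  set J := insert x (insert y (insert w T)) with hJdef
  have hJ : J ⊆ Finset.Icc 1 (n - 1) := by
    intro t ht
    simp only [hJdef, Finset.mem_insert] at ht
    rcases ht with rfl | rfl | rfl | ht
    · simp; omega
    · simp; omega
    · exact hw
    · exact hT ht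
  have hJc : J.card = d + 2 := by
    rw [hJdef, Finset.card_insert_of_notMem, Finset.card_insert_of_notMem,
      Finset.card_insert_of_notMem hwT]
    · omega
    · simp [hyT]; omega
    · simp [hxT]; omega
  have ex : J.erase x = insert w (insert y T) := by grind
  have ey : J.erase y = insert w (insert x T) := by grind
  have ew : J.erase w = insert x (insert y T) := by grind
  by_contra hne
  have k := core hS J hJ hJc x y (by grind) (by grind) hxy (by grind)
    (by rw [ex, ey]; tauto) w (by grind)
  rw [ew, h] at k
  rcases hwg with hwg | hwg
  · have c : (J.filter (y < ·)).card = (T.filter (y < ·)).card := by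
      congr 1; grind
    rw [c] at k
    have : ¬ x < w := by omega
    tauto
  · have c : (J.filter (y < ·)).card = (T.filter (y < ·)).card + 1 := by
      rw [← Finset.card_insert_of_notMem (s := T.filter (y < ·)) (a := w) (by simp [hwT])]
      congr 1; grind
    rw [c, Nat.even_add_one] at k
    have : x < w := by omega
    tauto

def Fits {d : ℕ} (n : ℕ) (y : Fin d → ℕ) (i : Fin d) (v : ℕ) : Prop :=
  1 ≤ v ∧ v ≤ n - 1 ∧ (∀ j, j < i → y j < v) ∧ (∀ j, i < j → v < y j)

def Good {d : ℕ} (n : ℕ) (y : Fin d → ℕ) : Prop :=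
  StrictMono y ∧ ∀ i, 1 ≤ y i ∧ y i ≤ n - 1

def Tt {d : ℕ} (y : Fin d → ℕ) (i : Fin d) : Finset ℕ := (Finset.univ.erase i).image y

def Cl {d : ℕ} (n : ℕ) (I : Set (Finset ℕ)) (y : Fin d → ℕ) (i : Fin d) (v : ℕ) : Prop :=
  Fits n y i v ∧ (v = y i ∨ (insert v (insert (y i) (Tt y i)) ∈ I ↔ Even (d - 1 - (i : ℕ))))

section
variable {d n : ℕ} {I : Set (Finset ℕ)} {y : Fin d → ℕ}

lemma Good.fits (hy : Good n y) (i : Fin d) : Fits n y i (y i) :=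
  ⟨(hy.2 i).1, (hy.2 i).2, fun _ h => hy.1 h, fun _ h => hy.1 h⟩

lemma Good.cl (hy : Good n y) (i : Fin d) : Cl n I y i (y i) := ⟨hy.fits i, Or.inl rfl⟩

lemma Good.update (hy : Good n y) {i : Fin d} {v : ℕ} (h : Fits n y i v) :
    Good n (Function.update y i v) := by
  obtain ⟨h1, h2, h3, h4⟩ := h
  constructor
  · intro a b hab
    have := hy.1 hab
    by_cases ha : a = i
    · subst ha
      have hb : b ≠ a := hab.ne'
      simp [Function.update_of_ne hb, h4 b hab]
    · by_cases hb : b = i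
      · subst hb
        simp [Function.update_of_ne ha, h3 a hab]
      · simpa [Function.update_of_ne ha, Function.update_of_ne hb]
  · intro a
    by_cases ha : a = i
    · subst ha; simp [h1, h2]
    · simpa [Function.update_of_ne ha] using hy.2 a

lemma Tt_update (i : Fin d) (v : ℕ) : Tt (Function.update y i v) i = Tt y i := by
  apply Finset.image_congr
  intro a ha
  have : a ≠ i := by simpa using ha
  simp [Function.update_of_ne this]

lemma insert_Tt (i : Fin d) : insert (y i) (Tt y i) = Finset.univ.image y := by
  unfold Tt
  rw [← Finset.image_insert, Finset.insert_erase (Finset.mem_univ i)]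

lemma Good.Tt_sub (hy : Good n y) (i : Fin d) : Tt y i ⊆ Finset.Icc 1 (n - 1) := by
  intro t ht
  obtain ⟨j, _, rfl⟩ := Finset.mem_image.1 ht
  exact Finset.mem_Icc.2 (hy.2 j)

lemma Good.Tt_card (hy : Good n y) (i : Fin d) : (Tt y i).card + 1 = d := by
  unfold Tt
  rw [Finset.card_image_of_injective _ hy.1.injective, Finset.card_erase_of_mem (Finset.mem_univ i)]
  have := i.2
  simp; omega

lemma Good.Tt_gap {i : Fin d} {u v : ℕ} (hu : Fits n y i u) (hv : Fits n y i v) :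
    ∀ t ∈ Tt y i, t < u ∨ v < t := by
  intro t ht
  obtain ⟨j, hj, rfl⟩ := Finset.mem_image.1 ht
  have hj : j ≠ i := by simpa using hj
  rcases lt_or_gt_of_ne hj with h | h
  · exact Or.inl (hu.2.2.1 j h)
  · exact Or.inr (hv.2.2.2 j h)

lemma Good.Tt_filter (hy : Good n y) {i : Fin d} {v : ℕ} (hv : Fits n y i v) :
    ((Tt y i).filter (v < ·)).card = d - 1 - (i : ℕ) := by
  have : (Tt y i).filter (v < ·) = (Finset.Ioi i).image y := by
    ext t
    simp only [Tt, Finset.mem_filter, Finset.mem_image, Finset.mem_erase, Finset.mem_univ,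
      and_true, Finset.mem_Ioi]
    constructor
    · rintro ⟨⟨j, hj, rfl⟩, hlt⟩
      refine ⟨j, ?_, rfl⟩
      rcases lt_or_gt_of_ne hj with h | h
      · have := hv.2.2.1 j h; omega
      · exact h
    · rintro ⟨j, hj, rfl⟩
      exact ⟨⟨j, hj.ne', rfl⟩, hv.2.2.2 j hj⟩
  rw [this, Finset.card_image_of_injective _ hy.1.injective, Fin.card_Ioi]

lemma Good.three (hS : SupCons d n I) (hy : Good n y) {i : Fin d} {u v w : ℕ}
    (hu : Fits n y i u) (hw : Fits n y i w) (huv : u < v) (hvw : v < w) :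
    (insert u (insert w (Tt y i)) ∈ I ↔ Even (d - 1 - (i : ℕ))) ↔
      ((insert u (insert v (Tt y i)) ∈ I ↔ Even (d - 1 - (i : ℕ))) ∧
       (insert v (insert w (Tt y i)) ∈ I ↔ Even (d - 1 - (i : ℕ)))) :=
  _root_.three hS _ (hy.Tt_sub i) (hy.Tt_card i) u v w huv hvw hu.1 hw.2.1
    (Good.Tt_gap hu hw) _ (by rw [hy.Tt_filter hw])

lemma Fits.between {i : Fin d} {u v w : ℕ} (hu : Fits n y i u) (hw : Fits n y i w)
    (huv : u ≤ v) (hvw : v ≤ w) : Fits n y i v :=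
  ⟨hu.1.trans huv, hvw.trans hw.2.1, fun j hj => (hu.2.2.1 j hj).trans_le huv,
    fun j hj => hvw.trans_lt (hw.2.2.2 j hj)⟩

/-- classes are convex -/
lemma Good.conv (hS : SupCons d n I) (hy : Good n y) {i : Fin d} {u v : ℕ}
    (hu : Cl n I y i u) (h : (u ≤ v ∧ v ≤ y i) ∨ (y i ≤ v ∧ v ≤ u)) : Cl n I y i v := by
  have hyi := hy.fits i
  obtain ⟨fu, hu⟩ := hu
  by_cases hvy : v = y i
  · subst hvy; exact hy.cl i
  by_cases huv : v = u
  · subst huv; exact ⟨fu, hu⟩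
  rcases h with ⟨h1, h2⟩ | ⟨h1, h2⟩
  · refine ⟨fu.between hyi h1 h2, Or.inr ?_⟩
    have := hy.three hS fu hyi (v := v) (by omega) (by omega)
    exact (this.1 (hu.resolve_left (by omega))).2
  · refine ⟨hyi.between fu h1 h2, Or.inr ?_⟩
    have := hy.three hS hyi fu (v := v) (by omega) (by omega)
    rw [Finset.insert_comm (y i) u, Finset.insert_comm (y i) v] at this
    exact (this.1 (hu.resolve_left (by omega))).1

lemma Good.same (hS : SupCons d n I) (hy : Good n y) {i : Fin d} {v w : ℕ}
    (hv : Cl n I y i v) (hw : Cl n I y i w) : Cl n I (Function.update y i v) i w := by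
  obtain ⟨fv, hv⟩ := hv
  obtain ⟨fw, hw⟩ := hw
  have hyi := hy.fits i
  have f : Fits n (Function.update y i v) i w := by
    refine ⟨fw.1, fw.2.1, fun j hj => ?_, fun j hj => ?_⟩
    · rw [Function.update_of_ne hj.ne]; exact fw.2.2.1 j hj
    · rw [Function.update_of_ne hj.ne']; exact fw.2.2.2 j hj
  refine ⟨f, ?_⟩
  rw [Tt_update, Function.update_self]
  by_cases h1 : w = v
  · exact Or.inl h1
  right
  by_cases h2 : v = y i
  · subst h2; exact hw.resolve_left h1
  have hv := hv.resolve_left h2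
  by_cases h3 : w = y i
  · subst h3; rw [Finset.insert_comm]; exact hv
  have hw := hw.resolve_left h3
  have c1 := Finset.insert_comm v (y i) (Tt y i)
  have c2 := Finset.insert_comm w (y i) (Tt y i)
  have c3 := Finset.insert_comm w v (Tt y i)
  rcases lt_trichotomy v w with a | a | a
  · rcases lt_trichotomy (y i) v with b | b | b
    · have := hy.three hS hyi fw b a
      rw [← c3, ← c2] at this; exact (this.1 hw).2
    · omega
    · rcases lt_trichotomy (y i) w with c | c | c
      · have := hy.three hS fv fw b c
        rw [← c3, ← c2] at this; exact this.2 ⟨hv, hw⟩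
      · omega
      · have := hy.three hS fv hyi a c
        rw [← c3] at this; exact (this.1 hv).1
  · omega
  · rcases lt_trichotomy (y i) w with b | b | b
    · have := hy.three hS hyi fv b a
      rw [← c1] at this; exact (this.1 hv).2
    · omega
    · rcases lt_trichotomy (y i) v with c | c | c
      · have := hy.three hS fw fv b c
        rw [← c1] at this; exact this.2 ⟨hw, hv⟩
      · omega
      · have := hy.three hS fw hyi a c
        exact (this.1 hw).1

/-- Adjacent coordinates have complementary classes. -/
lemma Good.not_both (hy : Good n y) {i j : Fin d} {v : ℕ} (hij : (j : ℕ) = i + 1)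
    (h1 : y i < v) (h2 : v < y j) : Cl n I y i v ↔ ¬ Cl n I y j v := by
  have hil : i < j := by rw [Fin.lt_def]; omega
  have f1 : Fits n y i v := by
    refine ⟨by omega, by have := hy.2 j; omega, fun k hk => (hy.1 hk).trans h1, fun k hk => ?_⟩
    have : j ≤ k := by rw [Fin.le_def]; rw [Fin.lt_def] at hk; omega
    exact h2.trans_le (hy.1.monotone this)
  have f2 : Fits n y j v := by
    refine ⟨by omega, by have := hy.2 j; omega, fun k hk => ?_, fun k hk => h2.trans (hy.1 hk)⟩
    have : k ≤ i := by rw [Fin.le_def]; rw [Fin.lt_def] at hk; omega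
    exact (hy.1.monotone this).trans_lt h1
  unfold Cl
  rw [insert_Tt, insert_Tt]
  have e : d - 1 - (i : ℕ) = d - 1 - (j : ℕ) + 1 := by have := j.2; omega
  rw [e, Nat.even_add_one]
  have n1 : v ≠ y i := by omega
  have n2 : v ≠ y j := by omega
  simp only [f1, f2, n1, n2, true_and, false_or]
  tauto

lemma Good.other (hS : SupCons d n I) (hy : Good n y) {i j : Fin d} (hij : j ≠ i) {v w : ℕ}
    (hv : Cl n I y i v) (hw : Cl n I y j w) : Cl n I (Function.update y i v) j w := by
  have hy' := hy.update hv.1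
  by_cases h1 : v = y i
  · subst h1; rwa [Function.update_eq_self]
  by_cases h2 : w = y j
  · subst h2
    have := hy'.cl (I := I) j
    rwa [Function.update_of_ne hij] at this
  -- the new value of coordinate `i` stays on the correct side of `w`
  have key1 : i < j → v < w := by
    intro hlt
    by_contra hle
    have hvj := hv.1.2.2.2 j hlt
    have hiw := hw.1.2.2.1 i hlt
    have hadj : (j : ℕ) = i + 1 := by
      by_contra hne
      have hk : (i : ℕ) + 1 < d := by have := j.2; rw [Fin.lt_def] at hlt; omega
      have a1 := hv.1.2.2.2 ⟨i + 1, hk⟩ (by rw [Fin.lt_def]; simp)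
      have a2 := hw.1.2.2.1 ⟨i + 1, hk⟩ (by rw [Fin.lt_def] at *; simp; omega)
      omega
    have hcj : Cl n I y j v := hy.conv hS hw (Or.inl ⟨by omega, by omega⟩)
    exact (hy.not_both hadj (by omega) hvj).1 hv hcj
  have key2 : j < i → w < v := by
    intro hlt
    by_contra hle
    have hvj := hv.1.2.2.1 j hlt
    have hiw := hw.1.2.2.2 i hlt
    have hadj : (i : ℕ) = j + 1 := by
      by_contra hne
      have hk : (j : ℕ) + 1 < d := by have := i.2; rw [Fin.lt_def] at hlt; omega
      have a1 := hw.1.2.2.2 ⟨j + 1, hk⟩ (by rw [Fin.lt_def]; simp)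
      have a2 := hv.1.2.2.1 ⟨j + 1, hk⟩ (by rw [Fin.lt_def] at *; simp; omega)
      omega
    have hcj : Cl n I y j v := hy.conv hS hw (Or.inr ⟨by omega, by omega⟩)
    exact (hy.not_both hadj hvj (by omega)).1 hcj hv
  have hyi := hy.fits i
  have f : Fits n (Function.update y i v) j w := by
    refine ⟨hw.1.1, hw.1.2.1, fun k hk => ?_, fun k hk => ?_⟩
    · by_cases hki : k = i
      · subst hki; rw [Function.update_self]; exact key1 hk
      · rw [Function.update_of_ne hki]; exact hw.1.2.2.1 k hk
    · by_cases hki : k = i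
      · subst hki; rw [Function.update_self]; exact key2 hk
      · rw [Function.update_of_ne hki]; exact hw.1.2.2.2 k hk
  refine ⟨f, Or.inr ?_⟩
  have hwI := hw.2.resolve_left h2
  have hvI := hv.2.resolve_left h1
  rw [insert_Tt, ← insert_Tt i, Function.update_self, Tt_update]
  rw [insert_Tt, ← insert_Tt i] at hwI
  rw [← hwI]
  have hwT : w ∉ Tt y i := by
    intro hmem
    obtain ⟨k, hk, rfl⟩ := Finset.mem_image.1 hmem
    rcases lt_trichotomy k j with h | h | h
    · exact lt_irrefl _ (hw.1.2.2.1 k h)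
    · exact h2 (by rw [h])
    · exact lt_irrefl _ (hw.1.2.2.2 k h)
  have hside : (w < v ∧ w < y i) ∨ (v < w ∧ y i < w) := by
    rcases lt_or_gt_of_ne hij with h | h
    · exact Or.inl ⟨key2 h, hw.1.2.2.2 i h⟩
    · exact Or.inr ⟨key1 h, hw.1.2.2.1 i h⟩
  have hwm : w ∈ Finset.Icc 1 (n - 1) := Finset.mem_Icc.2 ⟨hw.1.1, hw.1.2.1⟩
  rcases lt_or_gt_of_ne h1 with h | h
  · exact four hS _ (hy.Tt_sub i) (hy.Tt_card i) v (y i) w h hv.1.1 hyi.2.1 hwm hwT (by omega)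
      (Good.Tt_gap hv.1 hyi) (by rw [hy.Tt_filter hyi]; exact hvI)
  · exact (four hS _ (hy.Tt_sub i) (hy.Tt_card i) (y i) v w h hyi.1 hv.1.2.1 hwm hwT (by omega)
      (Good.Tt_gap hyi hv.1) (by rw [hy.Tt_filter hv.1, Finset.insert_comm]; exact hvI)).symm

lemma Good.step (hS : SupCons d n I) (hy : Good n y) {i : Fin d} {v : ℕ}
    (hv : Cl n I y i v) : Cl n I (Function.update y i v) = Cl n I y := by
  have one : ∀ {y : Fin d → ℕ}, Good n y → ∀ {v : ℕ}, Cl n I y i v → ∀ {j : Fin d} {w : ℕ},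
      Cl n I y j w → Cl n I (Function.update y i v) j w := by
    intro y hy v hv j w hw
    by_cases hij : j = i
    · subst hij; exact hy.same hS hv hw
    · exact hy.other hS hij hv hw
  funext j w
  apply propext
  constructor
  · intro h
    have := one (hy.update hv.1) (one hy hv (hy.cl i)) h
    simpa using this
  · exact one hy hv

lemma Good.chain (hS : SupCons d n I) (hy : Good n y) {z : Fin d → ℕ}
    (hz : ∀ i, Cl n I y i (z i)) : Good n z ∧ Cl n I z = Cl n I y := by
  have key : ∀ k : ℕ, k ≤ d → Good n (fun i : Fin d => if (i : ℕ) < k then z i else y i) ∧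
      Cl n I (fun i : Fin d => if (i : ℕ) < k then z i else y i) = Cl n I y := by
    intro k
    induction k with
    | zero => intro _; simpa using hy
    | succ k ih =>
      intro hk
      obtain ⟨g, e⟩ := ih (by omega)
      have hc : Cl n I (fun i : Fin d => if (i : ℕ) < k then z i else y i) ⟨k, hk⟩ (z ⟨k, hk⟩) := by
        rw [e]; exact hz _
      have hu : (fun i : Fin d => if (i : ℕ) < k + 1 then z i else y i) =
          Function.update (fun i : Fin d => if (i : ℕ) < k then z i else y i) ⟨k, hk⟩ (z ⟨k, hk⟩) := by
        funext i
        by_cases hi : i = ⟨k, hk⟩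
        · subst hi; simp
        · rw [Function.update_of_ne hi]
          have : (i : ℕ) ≠ k := fun h => hi (Fin.ext h)
          have h2 : (i : ℕ) < k + 1 ↔ (i : ℕ) < k := by omega
          simp only [h2]
      rw [hu]
      exact ⟨g.update hc.1, (g.step hS hc).trans e⟩
  simpa using key d le_rfl

lemma Good.interval (hS : SupCons d n I) (hy : Good n y) (i : Fin d) :
    ∃ lo hi : ℕ, ∀ v, Cl n I y i v ↔ lo ≤ v ∧ v ≤ hi := by
  classical
  have hex : ∃ v, Cl n I y i v := ⟨_, hy.cl i⟩
  have hb : y i ≤ n - 1 := (hy.2 i).2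
  have hg := Nat.findGreatest_spec (P := Cl n I y i) hb (hy.cl i)
  have hgl := Nat.le_findGreatest (P := Cl n I y i) hb (hy.cl i)
  refine ⟨Nat.find hex, Nat.findGreatest (Cl n I y i) (n - 1), fun v => ⟨fun h => ?_, fun h => ?_⟩⟩
  · exact ⟨Nat.find_min' hex h, Nat.le_findGreatest h.1.2.1 h⟩
  · rcases le_total v (y i) with h1 | h1
    · exact hy.conv hS (Nat.find_spec hex) (Or.inl ⟨h.1, h1⟩)
    · exact hy.conv hS hg (Or.inr ⟨h1, h.2⟩)

lemma Good.rect (hS : SupCons d n I) (hd : 1 ≤ d) (hy : Good n y) :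
    ∃ a : Fin (d + 1) → ℕ, StrictMono a ∧ (∀ i, 1 ≤ a i ∧ a i ≤ n) ∧
      ∀ i v, Cl n I y i v ↔ a i.castSucc ≤ v ∧ v + 1 ≤ a i.succ := by
  choose lo hi h using fun i => hy.interval hS i
  obtain ⟨m, rfl⟩ : ∃ m, d = m + 1 := ⟨d - 1, by omega⟩
  have hyy : ∀ i, lo i ≤ y i ∧ y i ≤ hi i := fun i => (h i (y i)).1 (hy.cl i)
  have hlo : ∀ i, Cl n I y i (lo i) := fun i => (h i _).2 ⟨le_rfl, (hyy i).1.trans (hyy i).2⟩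
  have hhi : ∀ i, Cl n I y i (hi i) := fun i => (h i _).2 ⟨(hyy i).1.trans (hyy i).2, le_rfl⟩
  have adj : ∀ i : Fin m, hi i.castSucc + 1 = lo i.succ := by
    intro i
    have hlt : i.castSucc < i.succ := Fin.castSucc_lt_succ
    have a1 := (hhi i.castSucc).1.2.2.2 i.succ hlt
    have a2 := (hlo i.succ).1.2.2.1 i.castSucc hlt
    have b1 := hyy i.castSucc
    have b2 := hyy i.succ
    have key : ∀ v, y i.castSucc < v → v < y i.succ → (v ≤ hi i.castSucc ↔ ¬ lo i.succ ≤ v) := by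
      intro v h1 h2
      have := hy.not_both (I := I) (i := i.castSucc) (j := i.succ) (v := v) (by simp) h1 h2
      rw [h, h] at this
      constructor
      · intro h3 h4; exact this.1 ⟨by omega, h3⟩ ⟨h4, by omega⟩
      · intro h3; exact (this.2 (fun h4 => h3 h4.1)).2
    have k1 := key (hi i.castSucc + 1)
    have k2 := key (lo i.succ)
    omega
  have hs : ∀ i : Fin (m + 1), (Fin.snoc lo (hi (Fin.last m) + 1) : Fin (m + 2) → ℕ) i.succ = hi i + 1 := by
    intro i
    induction i using Fin.lastCases with
    | last => rw [Fin.succ_last]; simp [Fin.snoc_last]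
    | cast i => rw [← Fin.castSucc_succ, adj]; exact Fin.snoc_castSucc (α := fun _ => ℕ) _ _ _
  refine ⟨(Fin.snoc lo (hi (Fin.last m) + 1) : Fin (m + 2) → ℕ), ?_, ?_, ?_⟩
  · rw [Fin.strictMono_iff_lt_succ]
    intro i
    rw [hs, Fin.snoc_castSucc (α := fun _ => ℕ)]
    have := hyy i; omega
  · intro i
    induction i using Fin.lastCases with
    | last =>
      rw [Fin.snoc_last (α := fun _ => ℕ)]
      have := (hhi (Fin.last m)).1.2.1
      have := (hhi (Fin.last m)).1.1
      omega
    | cast i =>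
      rw [Fin.snoc_castSucc (α := fun _ => ℕ)]
      have := (hlo i).1.2.1
      have := (hlo i).1.1
      omega
  · intro i v
    rw [hs, Fin.snoc_castSucc (α := fun _ => ℕ), h]
    omega

end

def blk {d : ℕ} (n : ℕ) (I : Set (Finset ℕ)) (y : Fin d → ℕ) : Set (Finset ℕ) :=
  {Y | ∃ z : Fin d → ℕ, (∀ i, Cl n I y i (z i)) ∧ Y = Finset.image z Finset.univ}

lemma strictMono_image_inj {d : ℕ} {y z : Fin d → ℕ} (hy : StrictMono y) (hz : StrictMono z)
    (h : Finset.image y Finset.univ = Finset.image z Finset.univ) : y = z := by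
  apply (StrictMono.range_inj hy hz).1
  have := congrArg (fun s : Finset ℕ => (s : Set ℕ)) h
  simpa using this

lemma exists_enum {d n : ℕ} (Y : Finset ℕ) (hY : Y ⊆ Finset.Icc 1 (n - 1)) (hc : Y.card = d) :
    ∃ y : Fin d → ℕ, Good n y ∧ Y = Finset.image y Finset.univ := by
  refine ⟨Y.orderEmbOfFin hc, ⟨(Y.orderEmbOfFin hc).strictMono, fun i => ?_⟩, ?_⟩
  · exact Finset.mem_Icc.1 (hY (Y.orderEmbOfFin_mem hc i))
  · simp

theorem stmt_15 (d n : ℕ) (hd : 1 ≤ d) (hdn : d < n)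
    (I : Set (Finset ℕ))
    (hIv : ∀ X ∈ I, X ⊆ Finset.Icc 1 (n - 1) ∧ X.card = d + 1)
    (hsup : ∀ J : Finset ℕ, J ⊆ Finset.Icc 1 (n - 1) → J.card = d + 2 →
      I ∩ {Y : Finset ℕ | Y ⊆ J ∧ Y.card = d + 1} = ∅ ∨
      {Y : Finset ℕ | Y ⊆ J ∧ Y.card = d + 1} ⊆ I ∨
      ((∀ Y, Y ⊆ J → Y.card = d + 1 → ∀ Z, Z ⊆ J → Z.card = d + 1 →
          Z ∈ I → lexLtN Y Z → Y ∈ I) ∧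
        Odd (I ∩ {Y : Finset ℕ | Y ⊆ J ∧ Y.card = d + 1}).ncard) ∨
      ((∀ Y, Y ⊆ J → Y.card = d + 1 → ∀ Z, Z ⊆ J → Z.card = d + 1 →
          Z ∈ I → lexLtN Z Y → Y ∈ I) ∧
        (I ∩ {Y : Finset ℕ | Y ⊆ J ∧ Y.card = d + 1}).ncard % 2 = d % 2)) :
    ∃ W : Set (Set (Finset ℕ)), SnugPartition n d W ∧
      ∀ X : Finset ℕ, X ⊆ Finset.Icc 1 (n - 1) → X.card = d + 1 →
        (X ∈ I ↔
          SameBlock W (X.erase (X.sup id))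
            (X.erase ((X.erase (X.sup id)).sup id))) := by

  classical
  have hS : SupCons d n I := hsup
  refine ⟨{B | ∃ y : Fin d → ℕ, Good n y ∧ B = blk n I y}, ⟨?_, ?_⟩, ?_⟩
  · rintro B ⟨y, hy, rfl⟩
    obtain ⟨a, ha, hb, hc⟩ := hy.rect hS hd
    refine ⟨a, ha, hb, ?_⟩
    unfold blk snugRect
    simp only [hc]
  · intro Y hY hYc
    obtain ⟨y, hy, rfl⟩ := exists_enum Y hY hYc
    refine ⟨blk n I y, ⟨⟨y, hy, rfl⟩, ⟨y, hy.cl, rfl⟩⟩, ?_⟩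
    rintro B ⟨⟨w, hw, rfl⟩, ⟨z, hz, hyz⟩⟩
    obtain ⟨g, e⟩ := hw.chain hS hz
    have := strictMono_image_inj hy.1 g.1 hyz
    subst this
    unfold blk
    rw [e]
  · intro X hX hXc
    have hne : X.Nonempty := Finset.card_pos.1 (by omega)
    have hm : X.sup id ∈ X := by
      obtain ⟨x, hx, e⟩ := Finset.exists_mem_eq_sup X hne id
      rw [e]; exact hx
    set m := X.sup id with hmdef
    have hYc : (X.erase m).card = d := by rw [Finset.card_erase_of_mem hm]; omega
    have hYs : X.erase m ⊆ Finset.Icc 1 (n - 1) := (Finset.erase_subset _ _).trans hX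
    obtain ⟨y, hy, hYy⟩ := exists_enum (X.erase m) hYs hYc
    obtain ⟨k, rfl⟩ : ∃ k, d = k + 1 := ⟨d - 1, by omega⟩
    have hylt : ∀ i, y i < m := by
      intro i
      have h1 : y i ∈ X.erase m := by rw [hYy]; simp
      have h2 : y i ≤ m := Finset.le_sup (f := id) (Finset.mem_of_mem_erase h1)
      exact lt_of_le_of_ne h2 (Finset.ne_of_mem_erase h1)
    have hm' : (X.erase m).sup id = y (Fin.last k) := by
      rw [hYy]
      apply le_antisymm
      · apply Finset.sup_le
        intro t ht
        obtain ⟨j, _, rfl⟩ := Finset.mem_image.1 ht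
        exact hy.1.monotone (Fin.le_last j)
      · exact Finset.le_sup (f := id) (b := y (Fin.last k)) (by simp)
    have hf : Fits n y (Fin.last k) m := by
      have := Finset.mem_Icc.1 (hX hm)
      exact ⟨this.1, this.2, fun j _ => hylt j, fun j hj => absurd hj (Fin.le_last j).not_gt⟩
    have hXi : X = insert m (Finset.image y Finset.univ) := by
      rw [← hYy, Finset.insert_erase hm]
    have hZ : X.erase (y (Fin.last k)) =
        Finset.image (Function.update y (Fin.last k) m) Finset.univ := by
      rw [← insert_Tt (Fin.last k), Function.update_self, Tt_update, hXi, ← insert_Tt (Fin.last k),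
        Finset.insert_comm, Finset.erase_insert]
      intro hmem
      rcases Finset.mem_insert.1 hmem with h | h
      · exact (hylt _).ne h
      · obtain ⟨j, hj, e⟩ := Finset.mem_image.1 h
        exact (Finset.mem_erase.1 hj).1 (hy.1.injective e)
    have hcl : Cl n I y (Fin.last k) m ↔ X ∈ I := by
      unfold Cl
      rw [insert_Tt, ← hXi]
      have : m ≠ y (Fin.last k) := (hylt _).ne'
      simp [hf, this]
    rw [hm', hYy, hZ, ← hcl]
    constructor
    · intro h
      refine ⟨blk n I y, ⟨y, hy, rfl⟩, ⟨y, hy.cl, rfl⟩, ⟨_, fun i => ?_, rfl⟩⟩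
      by_cases hi : i = Fin.last k
      · subst hi; rwa [Function.update_self]
      · rw [Function.update_of_ne hi]; exact hy.cl i
    · rintro ⟨B, ⟨w, hw, rfl⟩, ⟨y1, h1, e1⟩, ⟨z1, h2, e2⟩⟩
      obtain ⟨g1, c1⟩ := hw.chain hS h1
      obtain ⟨g2, c2⟩ := hw.chain hS h2
      have q1 := strictMono_image_inj hy.1 g1.1 e1
      have q2 := strictMono_image_inj (hy.update hf).1 g2.1 e2
      subst q1
      have := h2 (Fin.last k)
      rw [← q2, Function.update_self, ← c1] at this
      exact this
end

section
/- Let 1 ≤ d < n−1 and let W and W' be snug partitions of the d-element subsets of [n−1] such that for some a_1 < a_2 < … < a_{d+2} in [n], W and W' have exactly the same blocks except that W contains the blocks r(a_1,…,â_i,…,a_{d+2}) (omitting a_i) for all i ∈ {1,…,d+2} with i ≢ d (mod 2), while W' instead contains the blocks r(a_1,…,â_i,…,a_{d+2}) for all i with i ≡ d (mod 2). Then the inversion sets satisfy I(W) = I(W') ⊔ r(a_1,…,a_{d+2}), a disjoint union, where r(a_1,…,a_{d+2}) denotes the snug rectangle of (d+1)-element subsets of [n−1] determined by a_1 < … < a_{d+2},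 and I(W) denotes the set of (d+1)-element subsets X = {x_1 < … < x_{d+1}} of [n−1] such that X∖{x_{d+1}} and X∖{x_d} lie in the same block of W. -/
/-- The inversion set of a snug partition `W`: the `(d+1)`-element subsets
`X = {x₁<…<x_{d+1}}` of `[n-1]` such that `X \ {x_{d+1}}` and `X \ {x_d}`
(erase the largest, resp. second largest, element) lie in the same block. -/
def InvSetP (n d : ℕ) (W : Set (Set (Finset ℕ))) : Set (Finset ℕ) :=
  {X | X ⊆ Finset.Icc 1 (n - 1) ∧ X.card = d + 1 ∧
    SameBlock W (X.erase (X.sup id)) (X.erase ((X.erase (X.sup id)).sup id))}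

/-- The list of parameters `a₁ < … < a_{d+2}` (1-based, given by `a`) with the
`i`-th one omitted: `a₁, …, â_i, …, a_{d+2}`. -/
def aOmit (d : ℕ) (a : ℕ → ℕ) (i : ℕ) : Fin (d + 1) → ℕ :=
  fun k => if k.val + 1 < i then a (k.val + 1) else a (k.val + 2)

lemma sr_mem {k : ℕ} (b : Fin (k + 1) → ℕ) (z : ℕ → ℕ)
    (hz : ∀ i j, i < j → j < k → z i < z j) :
    (Finset.range k).image z ∈ snugRect b ↔
      ∀ i : Fin k, b i.castSucc ≤ z i.val ∧ z i.val + 1 ≤ b i.succ := by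
  have him : (Finset.range k).image z = Finset.image (fun i : Fin k => z i.val) Finset.univ := by
    ext t
    simp only [Finset.mem_image, Finset.mem_range, Finset.mem_univ, true_and]
    constructor
    · rintro ⟨i, hi, rfl⟩
      exact ⟨⟨i, hi⟩, rfl⟩
    · rintro ⟨i, rfl⟩
      exact ⟨i.val, i.isLt, rfl⟩
  constructor
  · rintro ⟨y, hy, hY⟩
    have hym : StrictMono y := by
      cases k with
      | zero => intro i; exact i.elim0
      | succ m =>
        rw [Fin.strictMono_iff_lt_succ]
        intro i
        have h1 := (hy i.castSucc).2
        have h2 := (hy i.succ).1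
        rw [Fin.succ_castSucc] at h1
        omega
    have hzm : StrictMono (fun i : Fin k => z i.val) := fun i j hij => hz _ _ hij j.isLt
    have hr : Set.range (fun i : Fin k => z i.val) = Set.range y := by
      rw [him] at hY
      have := congrArg (fun s : Finset ℕ => (s : Set ℕ)) hY
      simpa using this
    have := (StrictMono.range_inj hzm hym).1 hr
    intro i
    have h2 := congrFun this i
    rw [h2]
    exact hy i
  · intro h
    exact ⟨fun i => z i.val, h, him⟩

lemma om_mem (d : ℕ) (a : ℕ → ℕ) (i : ℕ) (z : ℕ → ℕ)
    (hz : ∀ i j, i < j → j < d → z i < z j) :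
    (Finset.range d).image z ∈ snugRect (aOmit d a i) ↔
      ∀ k < d, (if k + 1 < i then a (k + 1) else a (k + 2)) ≤ z k ∧
        z k < (if k + 2 < i then a (k + 2) else a (k + 3)) := by
  rw [sr_mem _ _ hz]
  constructor
  · intro h k hk
    exact h ⟨k, hk⟩
  · intro h k
    exact h k.val k.isLt

lemma exists_enum_s16 (m : ℕ) (X : Finset ℕ) (hX : X.card = m) :
    ∃ x : ℕ → ℕ, (∀ i j, i < j → j < m → x i < x j) ∧ X = (Finset.range m).image x := by
  refine ⟨fun i => if h : i < m then X.orderEmbOfFin hX ⟨i, h⟩ else 0, ?_, ?_⟩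
  · intro i j hij hj
    have hi : i < m := by omega
    simp only [hi, hj, dif_pos]
    exact (X.orderEmbOfFin hX).strictMono hij
  · ext t
    have : t ∈ X ↔ t ∈ Set.range (X.orderEmbOfFin hX) := by
      rw [Finset.range_orderEmbOfFin]; rfl
    rw [this]
    simp only [Set.mem_range, Finset.mem_image, Finset.mem_range]
    constructor
    · rintro ⟨i, rfl⟩
      exact ⟨i.val, i.isLt, by simp⟩
    · rintro ⟨i, hi, h⟩
      rw [dif_pos hi] at h
      exact ⟨_, h⟩

lemma sup_enum (m : ℕ) (x : ℕ → ℕ) (hx : ∀ i j, i < j → j < m + 1 → x i < x j) :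
    ((Finset.range (m + 1)).image x).sup id = x m := by
  apply le_antisymm
  · apply Finset.sup_le
    intro t ht
    simp only [Finset.mem_image, Finset.mem_range] at ht
    obtain ⟨i, hi, rfl⟩ := ht
    rcases Nat.lt_or_ge i m with h | h
    · exact (hx i m h (by omega)).le
    · have : i = m := by omega
      subst this; exact le_rfl
  · exact Finset.le_sup (f := id) (Finset.mem_image_of_mem x (by simp))

lemma erase_last (m : ℕ) (x : ℕ → ℕ) (hx : ∀ i j, i < j → j < m + 1 → x i < x j) :
    ((Finset.range (m + 1)).image x).erase (x m) = (Finset.range m).image x := by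
  rw [Finset.range_add_one, Finset.image_insert, Finset.erase_insert]
  simp only [Finset.mem_image, Finset.mem_range, not_exists, not_and]
  intro i hi
  exact (hx i m hi (by omega)).ne

lemma erase_pen (e : ℕ) (x : ℕ → ℕ) (hx : ∀ i j, i < j → j < e + 2 → x i < x j) :
    ((Finset.range (e + 2)).image x).erase (x e) =
      (Finset.range (e + 1)).image (fun i => if i = e then x (e + 1) else x i) := by
  ext t
  simp only [Finset.mem_erase, Finset.mem_image, Finset.mem_range]
  constructor
  · rintro ⟨h1, i, hi, rfl⟩
    have : i ≠ e := by rintro rfl; exact h1 rfl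
    by_cases h : i = e + 1
    · exact ⟨e, by omega, by simp [h]⟩
    · exact ⟨i, by omega, by simp [this]⟩
  · rintro ⟨i, hi, rfl⟩
    by_cases h : i = e
    · simp only [h, if_true]
      exact ⟨(hx e (e + 1) (by omega) (by omega)).ne', e + 1, by omega, rfl⟩
    · simp only [h, if_false]
      exact ⟨(hx i e (by omega) (by omega)).ne, i, by omega, rfl⟩

lemma inv_iff (n e : ℕ) (W : Set (Set (Finset ℕ))) (x : ℕ → ℕ)
    (hx : ∀ i j, i < j → j < e + 2 → x i < x j) :
    (Finset.range (e + 2)).image x ∈ InvSetP n (e + 1) W ↔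
      (Finset.range (e + 2)).image x ⊆ Finset.Icc 1 (n - 1) ∧
      SameBlock W ((Finset.range (e + 1)).image x)
        ((Finset.range (e + 1)).image (fun i => if i = e then x (e + 1) else x i)) := by
  have hc : ((Finset.range (e + 2)).image x).card = e + 1 + 1 := by
    rw [Finset.card_image_of_injOn, Finset.card_range]
    intro i hi j hj hij
    simp only [Finset.coe_range, Set.mem_Iio] at hi hj
    by_contra hne
    rcases Nat.lt_or_gt_of_ne hne with h | h
    · exact absurd hij (hx i j h hj).ne
    · exact absurd hij (hx j i h hi).ne'
  unfold InvSetP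
  rw [Set.mem_ofPred_eq, sup_enum (e + 1) x hx, erase_last (e + 1) x hx,
    sup_enum e x (fun i j h1 h2 => hx i j h1 (by omega)), erase_pen e x hx]
  simp only [hc, true_and]

/-- both in omitted rectangle -/
lemma om_mem_Z (e : ℕ) (a : ℕ → ℕ) (i : ℕ) (x : ℕ → ℕ)
    (hx : ∀ i j, i < j → j < e + 2 → x i < x j) :
    (Finset.range (e + 1)).image (fun i => if i = e then x (e + 1) else x i) ∈
        snugRect (aOmit (e + 1) a i) ↔
      (∀ k < e, (if k + 1 < i then a (k + 1) else a (k + 2)) ≤ x k ∧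
        x k < (if k + 2 < i then a (k + 2) else a (k + 3))) ∧
      (if e + 1 < i then a (e + 1) else a (e + 2)) ≤ x (e + 1) ∧
        x (e + 1) < (if e + 2 < i then a (e + 2) else a (e + 3)) := by
  rw [om_mem]
  · constructor
    · intro h
      refine ⟨fun k hk => ?_, ?_⟩
      · have := h k (by omega)
        rwa [if_neg (by omega : ¬ k = e)] at this
      · have := h e (by omega)
        rwa [if_pos rfl] at this
    · rintro ⟨h1, h2⟩ k hk
      by_cases h : k = e
      · subst h
        rw [if_pos rfl]; exact h2
      · rw [if_neg h]; exact h1 k (by omega)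
  · intro i j hij hj
    have hi : ¬ i = e := by omega
    rw [if_neg hi]
    split_ifs
    · exact hx _ _ (by omega) (by omega)
    · exact hx _ _ hij (by omega)

lemma om_mem_Y (e : ℕ) (a : ℕ → ℕ) (i : ℕ) (x : ℕ → ℕ)
    (hx : ∀ i j, i < j → j < e + 2 → x i < x j) :
    (Finset.range (e + 1)).image x ∈ snugRect (aOmit (e + 1) a i) ↔
      (∀ k < e, (if k + 1 < i then a (k + 1) else a (k + 2)) ≤ x k ∧
        x k < (if k + 2 < i then a (k + 2) else a (k + 3))) ∧
      (if e + 1 < i then a (e + 1) else a (e + 2)) ≤ x e ∧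
        x e < (if e + 2 < i then a (e + 2) else a (e + 3)) := by
  rw [om_mem _ _ _ _ (fun i j h1 h2 => hx i j h1 (by omega))]
  constructor
  · intro h
    exact ⟨fun k hk => h k (by omega), h e (by omega)⟩
  · rintro ⟨h1, h2⟩ k hk
    by_cases h : k = e
    · subst h; exact h2
    · exact h1 k (by omega)

lemma big_mem (e : ℕ) (a : ℕ → ℕ) (x : ℕ → ℕ)
    (hx : ∀ i j, i < j → j < e + 2 → x i < x j) :
    (Finset.range (e + 2)).image x ∈ snugRect (fun k : Fin (e + 1 + 2) => a (k.val + 1)) ↔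
      ∀ k < e + 2, a (k + 1) ≤ x k ∧ x k < a (k + 2) := by
  rw [sr_mem (k := e + 2) _ _ hx]
  constructor
  · intro h k hk
    exact h ⟨k, hk⟩
  · intro h k
    exact h k.val k.isLt

/-- transfer of special blocks between the two partitions -/
lemma transfer (n d : ℕ) (W W' W₀ S S' : Set (Set (Finset ℕ)))
    (hW : SnugPartition n d W) (hW' : SnugPartition n d W')
    (h : W = W₀ ∪ S) (h' : W' = W₀ ∪ S') (hS : ∀ B ∈ S, B ∉ W₀)
    (Y : Finset ℕ) (hY : Y ⊆ Finset.Icc 1 (n - 1)) (hc : Y.card = d)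
    (B : Set (Finset ℕ)) (hB : B ∈ S) (hYB : Y ∈ B) :
    (∀ C ∈ W₀, Y ∉ C) ∧ ∃ B' ∈ S', Y ∈ B' := by
  have key : ∀ C ∈ W₀, Y ∉ C := by
    intro C hC hYC
    have := (hW.2 Y hY hc).unique (y₁ := B) (y₂ := C)
      ⟨by rw [h]; exact Or.inr hB, hYB⟩ ⟨by rw [h]; exact Or.inl hC, hYC⟩
    exact hS B hB (this ▸ hC)
  refine ⟨key, ?_⟩
  obtain ⟨B', ⟨h1, h2⟩, -⟩ := hW'.2 Y hY hc
  rw [h'] at h1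
  rcases h1 with h1 | h1
  · exact absurd h2 (key B' h1)
  · exact ⟨B', h1, h2⟩

theorem stmt_16 (d n : ℕ) (hd : 1 ≤ d) (hdn : d < n - 1)
    (a : ℕ → ℕ)
    (ha : ∀ i j, 1 ≤ i → i < j → j ≤ d + 2 → a i < a j)
    (hab : ∀ i, 1 ≤ i → i ≤ d + 2 → 1 ≤ a i ∧ a i ≤ n)
    (W W' : Set (Set (Finset ℕ)))
    (hW : SnugPartition n d W) (hW' : SnugPartition n d W')
    (W₀ : Set (Set (Finset ℕ)))
    (hWeq : W = W₀ ∪ {B | ∃ i, 1 ≤ i ∧ i ≤ d + 2 ∧ i % 2 ≠ d % 2 ∧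
      B = snugRect (aOmit d a i)})
    (hW'eq : W' = W₀ ∪ {B | ∃ i, 1 ≤ i ∧ i ≤ d + 2 ∧ i % 2 = d % 2 ∧
      B = snugRect (aOmit d a i)})
    (hnew : ∀ i, 1 ≤ i → i ≤ d + 2 → snugRect (aOmit d a i) ∉ W₀) :
    InvSetP n d W =
      InvSetP n d W' ∪ snugRect (fun k : Fin (d + 2) => a (k.val + 1)) ∧
    InvSetP n d W' ∩ snugRect (fun k : Fin (d + 2) => a (k.val + 1)) = ∅ := by
  obtain ⟨e, rfl⟩ : ∃ e, d = e + 1 := ⟨d - 1, by omega⟩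
  have hbig : ∀ X ∈ snugRect (fun k : Fin (e + 1 + 2) => a (k.val + 1)),
      ∃ x : ℕ → ℕ, (∀ i j, i < j → j < e + 2 → x i < x j) ∧
        X = (Finset.range (e + 2)).image x ∧ X ⊆ Finset.Icc 1 (n - 1) := by
    rintro X ⟨y, hy, hX⟩
    have hym : StrictMono y := by
      rw [Fin.strictMono_iff_lt_succ]
      intro i
      have h1 := (hy i.castSucc).2
      have h2 := (hy i.succ).1
      simp at h1 h2
      omega
    have hc : X.card = e + 2 := by
      rw [hX, Finset.card_image_of_injective _ hym.injective]; simp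
    obtain ⟨x, hx, hXx⟩ := exists_enum_s16 _ X hc
    refine ⟨x, hx, hXx, ?_⟩
    rw [hX]
    intro t ht
    simp only [Finset.mem_image, Finset.mem_univ, true_and] at ht
    obtain ⟨i, rfl⟩ := ht
    have h1 := hy i
    have h2 := hab (i.val + 1) (by omega) (by omega)
    have h3 := hab (i.val + 2) (by omega) (by omega)
    simp at h1
    rw [show i.val + 1 + 1 = i.val + 2 from rfl] at h1
    rw [Finset.mem_Icc]
    omega
  -- facts about a given enumerated set
  have main : ∀ x : ℕ → ℕ, (∀ i j, i < j → j < e + 2 → x i < x j) →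
      (Finset.range (e + 2)).image x ⊆ Finset.Icc 1 (n - 1) →
      ((Finset.range (e + 2)).image x ∈ InvSetP n (e + 1) W ↔
        (Finset.range (e + 2)).image x ∈ InvSetP n (e + 1) W' ∨
        (Finset.range (e + 2)).image x ∈ snugRect (fun k : Fin (e + 1 + 2) => a (k.val + 1))) ∧
      ¬ ((Finset.range (e + 2)).image x ∈ InvSetP n (e + 1) W' ∧
        (Finset.range (e + 2)).image x ∈
          snugRect (fun k : Fin (e + 1 + 2) => a (k.val + 1))) := by
    intro x hx hsub
    rw [inv_iff n e W x hx, inv_iff n e W' x hx, big_mem e a x hx]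
    simp only [hsub, true_and]
    have hYs : (Finset.range (e + 1)).image x ⊆ Finset.Icc 1 (n - 1) :=
      (Finset.image_subset_image (Finset.range_subset_range.2 (by omega))).trans hsub
    have hYc : ((Finset.range (e + 1)).image x).card = e + 1 := by
      rw [Finset.card_image_of_injOn, Finset.card_range]
      intro i hi j hj hij
      simp only [Finset.coe_range, Set.mem_Iio] at hi hj
      by_contra hne
      rcases Nat.lt_or_gt_of_ne hne with h | h
      · exact absurd hij (hx i j h (by omega)).ne
      · exact absurd hij (hx j i h (by omega)).ne'
    have t1 := transfer n (e + 1) W W' W₀ _ _ hW hW' hWeq hW'eq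
      (by rintro B ⟨i, h1, h2, -, rfl⟩; exact hnew i h1 h2) _ hYs hYc
    have t2 := transfer n (e + 1) W' W W₀ _ _ hW' hW hW'eq hWeq
      (by rintro B ⟨i, h1, h2, -, rfl⟩; exact hnew i h1 h2) _ hYs hYc
    have hxe := hx e (e + 1) (by omega) (by omega)
    have ha1 := ha (e + 1) (e + 2) (by omega) (by omega) (by omega)
    have ha2 := ha (e + 2) (e + 3) (by omega) (by omega) (by omega)
    -- big rectangle implies membership in the block omitting d+1
    have bigY : (∀ k < e + 2, a (k + 1) ≤ x k ∧ x k < a (k + 2)) →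
        (Finset.range (e + 1)).image x ∈ snugRect (aOmit (e + 1) a (e + 2)) ∧
        (Finset.range (e + 1)).image (fun i => if i = e then x (e + 1) else x i) ∈
          snugRect (aOmit (e + 1) a (e + 2)) := by
      intro h
      have h1 := h e (by omega)
      have h2 := h (e + 1) (by omega)
      simp only [add_assoc, Nat.reduceAdd] at h1 h2
      rw [om_mem_Y e a _ x hx, om_mem_Z e a _ x hx]
      have h3 : ∀ k < e, (if k + 1 < e + 2 then a (k + 1) else a (k + 2)) ≤ x k ∧
          x k < (if k + 2 < e + 2 then a (k + 2) else a (k + 3)) := by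
        intro k hk
        rw [if_pos (by omega), if_pos (by omega)]
        exact h k (by omega)
      rw [if_pos (by omega), if_neg (by omega)]
      exact ⟨⟨h3, by omega, by omega⟩, ⟨h3, by omega, by omega⟩⟩
    refine ⟨⟨?_, ?_⟩, ?_⟩
    · rintro ⟨B, hB, hYB, hZB⟩
      rw [hWeq] at hB
      rcases hB with hB | hB
      · exact Or.inl ⟨B, by rw [hW'eq]; exact Or.inl hB, hYB, hZB⟩
      obtain ⟨-, B', ⟨j, hj1, hj2, hj3, rfl⟩, hYB'⟩ := t1 B hB hYB
      obtain ⟨i, hi1, hi2, hi3, rfl⟩ := hB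
      have hZ' : ∀ j, 1 ≤ j → j ≤ e + 1 + 2 → j % 2 = (e + 1) % 2 →
          (Finset.range (e + 1)).image (fun i => if i = e then x (e + 1) else x i) ∈
            snugRect (aOmit (e + 1) a j) →
          (Finset.range (e + 1)).image x ∈ snugRect (aOmit (e + 1) a j) →
          SameBlock W' ((Finset.range (e + 1)).image x)
            ((Finset.range (e + 1)).image (fun i => if i = e then x (e + 1) else x i)) := by
        intro j h1 h2 h3 h4 h5
        exact ⟨_, by rw [hW'eq]; exact Or.inr ⟨j, h1, h2, h3, rfl⟩, h5, h4⟩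
      rw [om_mem_Y e a _ x hx] at hYB hYB'
      rw [om_mem_Z e a _ x hx] at hZB
      obtain ⟨p1, p2, p3⟩ := hYB
      obtain ⟨q1, q2, q3⟩ := hYB'
      obtain ⟨-, r2, r3⟩ := hZB
      have r4 : x (e + 1) < a (e + 3) := by split_ifs at r3 <;> omega
      by_cases hlow : a (e + 2) ≤ x e
      · -- both in the top interval
        left
        have hj : ¬ e + 2 < j := by
          intro h; rw [if_pos h] at q3; omega
        have hj' : ¬ e + 1 < j := by omega
        refine hZ' j hj1 hj2 hj3 ?_ ?_
        · rw [om_mem_Z e a _ x hx, if_neg hj, if_neg hj']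
          exact ⟨q1, by omega, by omega⟩
        · rw [om_mem_Y e a _ x hx]
          exact ⟨q1, q2, q3⟩
      · have hi : i = e + 2 := by
          by_contra hne
          rw [if_neg (by omega)] at p2
          omega
        subst hi
        have p4 : ∀ k < e, a (k + 1) ≤ x k ∧ x k < a (k + 2) := by
          intro k hk
          have := p1 k hk
          rwa [if_pos (by omega), if_pos (by omega)] at this
        rw [if_pos (by omega)] at p2
        by_cases hup : a (e + 2) ≤ x (e + 1)
        · right
          intro k hk
          rcases Nat.lt_trichotomy k e with h | h | h
          · exact p4 k h
          · subst h; omega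
          · have : k = e + 1 := by omega
            subst this
            exact ⟨hup, r4⟩
        · left
          have p5 : ∀ k < e, (if k + 1 < e + 3 then a (k + 1) else a (k + 2)) ≤ x k ∧
              x k < (if k + 2 < e + 3 then a (k + 2) else a (k + 3)) := by
            intro k hk
            rw [if_pos (by omega), if_pos (by omega)]
            exact p4 k hk
          refine hZ' (e + 3) (by omega) (by omega) (by omega) ?_ ?_
          · rw [om_mem_Z e a _ x hx]
            rw [if_pos (by omega), if_pos (by omega)]
            exact ⟨p5, by omega, by omega⟩
          · rw [om_mem_Y e a _ x hx]
            rw [if_pos (by omega), if_pos (by omega)]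
            exact ⟨p5, by omega, by omega⟩
    · have hZ' : ∀ j, 1 ≤ j → j ≤ e + 1 + 2 → j % 2 ≠ (e + 1) % 2 →
          (Finset.range (e + 1)).image (fun i => if i = e then x (e + 1) else x i) ∈
            snugRect (aOmit (e + 1) a j) →
          (Finset.range (e + 1)).image x ∈ snugRect (aOmit (e + 1) a j) →
          SameBlock W ((Finset.range (e + 1)).image x)
            ((Finset.range (e + 1)).image (fun i => if i = e then x (e + 1) else x i)) := by
        intro j h1 h2 h3 h4 h5
        exact ⟨_, by rw [hWeq]; exact Or.inr ⟨j, h1, h2, h3, rfl⟩, h5, h4⟩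
      rintro (⟨B, hB, hYB, hZB⟩ | hbg)
      · rw [hW'eq] at hB
        rcases hB with hB | hB
        · exact ⟨B, by rw [hWeq]; exact Or.inl hB, hYB, hZB⟩
        obtain ⟨-, B', ⟨j, hj1, hj2, hj3, rfl⟩, hYB'⟩ := t2 B hB hYB
        obtain ⟨i, hi1, hi2, hi3, rfl⟩ := hB
        rw [om_mem_Y e a _ x hx] at hYB'
        rw [om_mem_Z e a _ x hx] at hZB
        obtain ⟨q1, q2, q3⟩ := hYB'
        obtain ⟨-, r2, r3⟩ := hZB
        have r4 : x (e + 1) < a (e + 3) := by split_ifs at r3 <;> omega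
        have hj : ¬ e + 2 < j := by omega
        refine hZ' j hj1 hj2 hj3 ?_ ?_
        · rw [om_mem_Z e a _ x hx, if_neg hj]
          exact ⟨q1, by omega, by omega⟩
        · rw [om_mem_Y e a _ x hx]
          exact ⟨q1, q2, q3⟩
      · exact hZ' (e + 2) (by omega) (by omega) (by omega) (bigY hbg).2 (bigY hbg).1
    · rintro ⟨⟨B, hB, hYB, hZB⟩, hbg⟩
      have h1 := t1 _ ⟨e + 2, by omega, by omega, by omega, rfl⟩ (bigY hbg).1
      rw [hW'eq] at hB
      rcases hB with hB | ⟨j, hj1, hj2, hj3, rfl⟩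
      · exact h1.1 B hB hYB
      · rw [om_mem_Y e a _ x hx] at hYB
        rw [om_mem_Z e a _ x hx] at hZB
        obtain ⟨-, p2, -⟩ := hYB
        obtain ⟨-, -, r3⟩ := hZB
        have h2 := hbg e (by omega)
        have h3 := hbg (e + 1) (by omega)
        simp only [add_assoc, Nat.reduceAdd] at h2 h3
        by_cases hj : e + 2 < j
        · rw [if_pos hj] at r3; omega
        · rw [if_neg (by omega)] at p2; omega
  have enumI : ∀ V : Set (Set (Finset ℕ)), ∀ X ∈ InvSetP n (e + 1) V,
      ∃ x : ℕ → ℕ, (∀ i j, i < j → j < e + 2 → x i < x j) ∧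
        X = (Finset.range (e + 2)).image x ∧ X ⊆ Finset.Icc 1 (n - 1) := by
    rintro V X ⟨h1, h2, -⟩
    obtain ⟨x, hx, hX⟩ := exists_enum_s16 _ X h2
    exact ⟨x, hx, hX, h1⟩
  constructor
  · ext X
    rw [Set.mem_union]
    constructor
    · intro h
      obtain ⟨x, hx, rfl, hs⟩ := enumI _ X h
      exact (main x hx hs).1.1 h
    · intro h
      obtain ⟨x, hx, rfl, hs⟩ := h.elim (enumI _ X) (hbig X)
      exact (main x hx hs).1.2 h
  · rw [Set.eq_empty_iff_forall_notMem]
    rintro X ⟨h1, h2⟩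
    obtain ⟨x, hx, rfl, hs⟩ := hbig X h2
    exact (main x hx hs).2 ⟨h1, h2⟩
end

section
/- Let 1 ≤ d < n−1, let a_1 < a_2 < … < a_{d+2} be elements of [n], and let R = r(a_1,…,a_{d+2}) be the corresponding snug rectangle of (d+1)-element subsets of [n−1]. Let β and β' be two rectangular linear orders on R. Then β and β' agree on every pair of elements of R lying in a common (d+1)-packet: for all Y, Z ∈ R with |Y ∪ Z| = d+2, Y precedes Z in β if and only if Y precedes Z in β'. -/
/-- A ranking function `β` (modelling a linear order) on the snug rectangle of
`(d+1)`-subsets with parameters `a : Fin (d+2) → ℕ` is rectangular if whenever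
`Y = {y₁<…<y_{d+1}}` lies in the rectangle and `Y'`, obtained by replacing `yᵢ`
with `yᵢ + 1`, also lies in the rectangle, then `Y'` precedes `Y` when
`(d+1) - i` is even, and `Y` precedes `Y'` when `(d+1) - i` is odd
(`i` is 1-based, so for `i : Fin (d+1)` the quantity `(d+1) - i` is `d - i.val`). -/
def Rectangular (d : ℕ) (β : Finset ℕ → ℕ) (a : Fin (d + 2) → ℕ) : Prop :=
  ∀ y : Fin (d + 1) → ℕ,
    (∀ i : Fin (d + 1), a i.castSucc ≤ y i ∧ y i + 1 ≤ a i.succ) →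
    ∀ i : Fin (d + 1), y i + 2 ≤ a i.succ →
      (((d - i.val) % 2 = 0 →
        β (Finset.image (Function.update y i (y i + 1)) Finset.univ) <
          β (Finset.image y Finset.univ)) ∧
      ((d - i.val) % 2 = 1 →
        β (Finset.image y Finset.univ) <
          β (Finset.image (Function.update y i (y i + 1)) Finset.univ)))

theorem snug_idx {d : ℕ} (a : Fin (d + 2) → ℕ) (ha : StrictMono a) (y z : Fin (d + 1) → ℕ)
    (hy : ∀ i : Fin (d + 1), a i.castSucc ≤ y i ∧ y i + 1 ≤ a i.succ)
    (hz : ∀ i : Fin (d + 1), a i.castSucc ≤ z i ∧ z i + 1 ≤ a i.succ)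
    (i j : Fin (d + 1)) (h : y i = z j) : i = j := by
  rcases lt_trichotomy i j with hl | hl | hl
  · have h1 : a i.succ ≤ a j.castSucc := ha.monotone (by
      rw [Fin.le_def]; simpa using hl)
    have := (hy i).2
    have := (hz j).1
    omega
  · exact hl
  · have h1 : a j.succ ≤ a i.castSucc := ha.monotone (by
      rw [Fin.le_def]; simpa using hl)
    have := (hz j).2
    have := (hy i).1
    omega

theorem rect_chain {d : ℕ} (a : Fin (d + 2) → ℕ) (β : Finset ℕ → ℕ) (hβ : Rectangular d β a)
    (y : Fin (d + 1) → ℕ)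
    (hy : ∀ i : Fin (d + 1), a i.castSucc ≤ y i ∧ y i + 1 ≤ a i.succ)
    (i : Fin (d + 1)) (v : ℕ) (hv : a i.castSucc ≤ v) (w : ℕ) (hvw : v + 1 ≤ w) :
    w + 1 ≤ a i.succ →
    (((d - i.val) % 2 = 0 →
        β (Finset.image (Function.update y i w) Finset.univ) <
          β (Finset.image (Function.update y i v) Finset.univ)) ∧
      ((d - i.val) % 2 = 1 →
        β (Finset.image (Function.update y i v) Finset.univ) <
          β (Finset.image (Function.update y i w) Finset.univ))) := by
  have step : ∀ u, a i.castSucc ≤ u → u + 2 ≤ a i.succ →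
    (((d - i.val) % 2 = 0 →
        β (Finset.image (Function.update y i (u+1)) Finset.univ) <
          β (Finset.image (Function.update y i u) Finset.univ)) ∧
      ((d - i.val) % 2 = 1 →
        β (Finset.image (Function.update y i u) Finset.univ) <
          β (Finset.image (Function.update y i (u+1)) Finset.univ))) := by
    intro u hu hu2
    have := hβ (Function.update y i u) (by
      intro j
      by_cases hj : j = i
      · subst hj; simp; omega
      · simpa [Function.update_of_ne hj] using hy j) i (by simpa using hu2)
    simpa using this
  induction w, hvw using Nat.le_induction with
  | base => intro h; exact step v hv (by omega)
  | succ w hw ih =>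
    intro h
    have h1 := ih (by omega)
    have h2 := step w (by omega) (by omega)
    exact ⟨fun hp => (h2.1 hp).trans (h1.1 hp), fun hp => (h1.2 hp).trans (h2.2 hp)⟩

theorem stmt_17 (d n : ℕ) (hd : 1 ≤ d) (hdn : d < n - 1)
    (a : Fin (d + 2) → ℕ) (ha : StrictMono a) (hab : ∀ i, 1 ≤ a i ∧ a i ≤ n)
    (β β' : Finset ℕ → ℕ)
    (hβinj : ∀ Y ∈ snugRect a, ∀ Z ∈ snugRect a, β Y = β Z → Y = Z)
    (hβ'inj : ∀ Y ∈ snugRect a, ∀ Z ∈ snugRect a, β' Y = β' Z → Y = Z)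
    (hβ : Rectangular d β a) (hβ' : Rectangular d β' a) :
    ∀ Y ∈ snugRect a, ∀ Z ∈ snugRect a, (Y ∪ Z).card = d + 2 →
      (β Y < β Z ↔ β' Y < β' Z) := by
  rintro Y ⟨y, hy, rfl⟩ Z ⟨z, hz, rfl⟩ hc
  have yinj : Function.Injective y := fun i j h => snug_idx a ha y y hy hy i j h
  have zinj : Function.Injective z := fun i j h => snug_idx a ha z z hz hz i j h
  have hU : Finset.image y Finset.univ ∪ Finset.image z Finset.univ =
      Finset.image y Finset.univ ∪ Finset.image z (Finset.univ.filter fun i => y i ≠ z i) := by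
    ext x
    simp only [Finset.mem_union, Finset.mem_image, Finset.mem_univ, true_and, Finset.mem_filter]
    constructor
    · rintro (h | ⟨j, rfl⟩)
      · exact Or.inl h
      · by_cases h : y j = z j
        · exact Or.inl ⟨j, h⟩
        · exact Or.inr ⟨j, h, rfl⟩
    · rintro (h | ⟨j, _, rfl⟩)
      · exact Or.inl h
      · exact Or.inr ⟨j, rfl⟩
  have hD : Disjoint (Finset.image y Finset.univ)
      (Finset.image z (Finset.univ.filter fun i => y i ≠ z i)) := by
    rw [Finset.disjoint_left]
    intro x hx hx'
    simp only [Finset.mem_image, Finset.mem_univ, true_and, Finset.mem_filter] at hx hx'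
    obtain ⟨i, rfl⟩ := hx
    obtain ⟨j, hj, h⟩ := hx'
    have := snug_idx a ha y z hy hz i j h.symm
    subst this
    exact hj h.symm
  rw [hU, Finset.card_union_of_disjoint hD, Finset.card_image_of_injective _ yinj,
    Finset.card_image_of_injective _ zinj, Finset.card_univ, Fintype.card_fin] at hc
  obtain ⟨i, hi⟩ := Finset.card_eq_one.mp (by omega :
    (Finset.univ.filter fun i => y i ≠ z i).card = 1)
  have hi' : ∀ j, y j ≠ z j ↔ j = i := by
    intro j
    have := Finset.ext_iff.mp hi j
    simpa using this
  have hzy : Function.update y i (z i) = z := by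
    funext j
    by_cases hj : j = i
    · subst hj; simp
    · rw [Function.update_of_ne hj]
      by_contra h
      exact hj ((hi' j).1 h)
  have hyy : Function.update y i (y i) = y := Function.update_eq_self i y
  have hne := (hi' i).2 rfl
  rcases lt_or_gt_of_ne hne with h | h
  · have h1 := rect_chain a β hβ y hy i (y i) (hy i).1 (z i) h (hz i).2
    have h2 := rect_chain a β' hβ' y hy i (y i) (hy i).1 (z i) h (hz i).2
    rw [hzy, hyy] at h1 h2
    omega
  · have h1 := rect_chain a β hβ y hy i (z i) (hz i).1 (y i) h (hy i).2
    have h2 := rect_chain a β' hβ' y hy i (z i) (hz i).1 (y i) h (hy i).2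
    rw [hzy, hyy] at h1 h2
    omega
end
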